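/- Let (A, [,], ∘) be an extended post-Lie algebra of weight (λ,κ) over a field k. Define {x,y} := x∘y − y∘x + λ[x,y]. Then {,} is a Lie bracket on A, i.e. it is bilinear, skew-symmetric, and satisfies the Jacobi identity {{x,y},z} + {{y,z},x} + {{z,x},y} = 0 for all x,y,z ∈ A. -/

import Mathlib

/-- A binary operation `f : A → A → A` is `k`-bilinear. -/
def IsBilinear (k : Type*) [Field k] {A : Type*} [AddCommGroup A] [Module k A]
    (f : A → A → A) : Prop :=
  (∀ (a : k) (x y z : A), f (a • x + y) z = a • f x z + f y z) ∧
  (∀ (a : k) (x y z : A), f x (a • y + z) = a • f x y + f x z)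

/-- `(A, br, circ)` is an extended post-Lie algebra of weight `(lam, kap)`:
`br` is a Lie bracket (bilinear, alternating, Jacobi) and the bilinear
operation `circ` satisfies the two compatibility conditions. -/
def IsExtPostLie (k : Type*) [Field k] {A : Type*} [AddCommGroup A] [Module k A]
    (lam kap : k) (br circ : A → A → A) : Prop :=
  IsBilinear k br ∧ IsBilinear k circ ∧
  (∀ x : A, br x x = 0) ∧
  (∀ x y z : A, br (br x y) z + br (br y z) x + br (br z x) y = 0) ∧
  (∀ x y z : A,
    circ (circ x y) z - circ (circ y x) z + lam • circ (br x y) z + kap • br (br x y) z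
      = circ x (circ y z) - circ y (circ x z)) ∧
  (∀ x y z : A, circ x (br y z) = br (circ x y) z + br y (circ x z))

namespace IsBilinear

variable {k A : Type*} [Field k] [AddCommGroup A] [Module k A] {f : A → A → A}

theorem add_left (hf : IsBilinear k f) (x y z : A) : f (x + y) z = f x z + f y z := by
  simpa using hf.1 1 x y z

theorem add_right (hf : IsBilinear k f) (x y z : A) : f x (y + z) = f x y + f x z := by
  simpa using hf.2 1 x y z

theorem zero_left (hf : IsBilinear k f) (z : A) : f 0 z = 0 := by
  simpa using hf.add_left 0 0 z

theorem zero_right (hf : IsBilinear k f) (z : A) : f z 0 = 0 := by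
  simpa using hf.add_right z 0 0

theorem smul_left (hf : IsBilinear k f) (a : k) (x z : A) : f (a • x) z = a • f x z := by
  simpa [hf.zero_left] using hf.1 a x 0 z

theorem smul_right (hf : IsBilinear k f) (a : k) (x z : A) : f x (a • z) = a • f x z := by
  simpa [hf.zero_right] using hf.2 a x z 0

theorem sub_left (hf : IsBilinear k f) (x y z : A) : f (x - y) z = f x z - f y z := by
  rw [eq_sub_iff_add_eq, ← hf.add_left, sub_add_cancel]

theorem sub_right (hf : IsBilinear k f) (x y z : A) : f x (y - z) = f x y - f x z := by
  rw [eq_sub_iff_add_eq, ← hf.add_right, sub_add_cancel]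

theorem skew_of_alternating (hf : IsBilinear k f) (alt : ∀ x, f x x = 0) (x y : A) :
    f x y = -f y x := by
  have h := alt (x + y)
  rw [hf.add_left, hf.add_right, hf.add_right, alt, alt, zero_add, add_zero] at h
  exact eq_neg_of_add_eq_zero_left h

end IsBilinear

/-- In an extended post-Lie algebra of weight `(lam, kap)`, the operation
`{x, y} := x ∘ y - y ∘ x + lam • [x, y]` is a Lie bracket: bilinear,
skew-symmetric and satisfying the Jacobi identity. -/
theorem extPostLie_brace_isLieBracket {k A : Type*} [Field k] [AddCommGroup A]
    [Module k A] (lam kap : k) (br circ : A → A → A)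
    (h : IsExtPostLie k lam kap br circ)
    (brace : A → A → A)
    (hbrace : ∀ x y, brace x y = circ x y - circ y x + lam • br x y) :
    IsBilinear k brace ∧
    (∀ x y : A, brace x y = - brace y x) ∧
    (∀ x y z : A, brace (brace x y) z + brace (brace y z) x + brace (brace z x) y = 0) := by
  obtain ⟨hbr, hcirc, alt, jacobi, assoc, deriv⟩ := h
  have skew := hbr.skew_of_alternating alt
  have double : ∀ x y z : A, brace (brace x y) z =
      circ x (circ y z) - circ y (circ x z) - kap • br (br x y) z
        - (circ z (circ x y) - circ z (circ y x))
        + lam • (br (circ x y) z - br (circ y x) z - br (circ z x) y + br (circ z y) x)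
        + (lam * lam) • br (br x y) z := by
    intro x y z
    simp only [hbrace, hcirc.add_left, hcirc.sub_left, hcirc.smul_left, hcirc.add_right,
      hcirc.sub_right, hcirc.smul_right, hbr.add_left, hbr.sub_left, hbr.smul_left, deriv]
    rw [skew x (circ z y)]
    linear_combination (norm := module) assoc x y z
  refine ⟨⟨fun a x y z => ?_, fun a x y z => ?_⟩, fun x y => ?_, fun x y z => ?_⟩
  · simp only [hbrace, hbr.1, hcirc.1, hcirc.2]
    module
  · simp only [hbrace, hbr.2, hcirc.1, hcirc.2]
    module
  · rw [hbrace, hbrace, skew x y]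
    module
  · rw [double, double, double]
    linear_combination (norm := module) (lam * lam - kap) • jacobi x y z
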